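/- Let (C•,d_C), (D•,d_D) be cochain complexes in 𝒞 with fixed lifts (C̄•,d̄_C), (D̄•,d̄_D) along F; write δ̄ = δ_{d̄_C,d̄_D}. Let f, g : C• → D• be cochain maps of degree n which are homotopic via a homotopy H : f → g. Then: (i) for any graded lifts f̄ of f and ḡ of g, δ̄(f̄) − δ̄(ḡ) = δ̄(γ) for some graded map γ with F(γ) = 0, so the obstruction classes of f and g against lifting to cochain maps coincide; and (ii) if these obstructions vanish, then for every cochain-map lift f̄ of f (i.e. F(f̄) = f and δ̄(f̄) = 0) there exists a cochain-map lift ḡ of g together with a graded lift H̄ of H satisfying δ̄(H̄) = ḡ − f̄. -/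

import Mathlib

open CategoryTheory

namespace Paper

/-- A graded object: a `ℤ`-indexed family of objects. -/
abbrev GradedObj (A : Type*) [Category A] := ℤ → A

/-- A graded map of degree `n` from `X` to `Y`. -/
abbrev GMap {A : Type*} [Category A] (X Y : GradedObj A) (n : ℤ) :=
  ∀ i : ℤ, X i ⟶ Y (i + n)

/-- Composition of graded maps, in diagrammatic order (`gcomp h f g` is "`g ∘ f`"),
with prescribed total degree `k = n + m`. -/
def gcomp {A : Type*} [Category A] {X Y Z : GradedObj A} {n m k : ℤ} (h : n + m = k)
    (f : GMap X Y n) (g : GMap Y Z m) : GMap X Z k :=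
  fun i => f i ≫ g (i + n) ≫ eqToHom (congrArg Z (show i + n + m = i + k by omega))

/-- The identity graded map of degree `0`. -/
def gid {A : Type*} [Category A] (X : GradedObj A) : GMap X X 0 :=
  fun i => eqToHom (congrArg X (add_zero i).symm)

/-- `δ(f) = d_Y ∘ f - (-1)ⁿ ⬝ f ∘ d_X` for pre-differentials `d_X`, `d_Y` and a graded
map `f` of degree `n`; the result has degree `m = n + 1`. -/
def gdelta {A : Type*} [Category A] [Preadditive A] {X Y : GradedObj A}
    (dX : GMap X X 1) (dY : GMap Y Y 1) {n m : ℤ} (h : n + 1 = m) (f : GMap X Y n) :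
    GMap X Y m :=
  gcomp h f dY - (n.negOnePow : ℤ) • gcomp (show 1 + n = m by omega) dX f

/-- The image of a graded object under a functor. -/
abbrev Fgr {A B : Type*} [Category A] [Category B] (F : B ⥤ A) (X : GradedObj B) :
    GradedObj A := fun i => F.obj (X i)

/-- The image of a graded map under a functor. -/
def Fmap {A B : Type*} [Category A] [Category B] (F : B ⥤ A) {X Y : GradedObj B} {n : ℤ}
    (f : GMap X Y n) : GMap (Fgr F X) (Fgr F Y) n := fun i => F.map (f i)

/-- `Ker(F)² = 0`: the composite of two `F`-killed morphisms vanishes. -/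
def KerSq {A B : Type*} [Category A] [Category B] [Preadditive A] [Preadditive B]
    (F : B ⥤ A) : Prop :=
  ∀ ⦃X Y Z : B⦄ (u : X ⟶ Y) (v : Y ⟶ Z), F.map u = 0 → F.map v = 0 → u ≫ v = 0

/-- `f : (X,dX) → (Y,dY)` and `g : (Y,dY) → (X,dX)` are cochain maps which are homotopy
inverse to each other. -/
def IsHomotopyEquivPair {A : Type*} [Category A] [Preadditive A] {X Y : GradedObj A}
    (dX : GMap X X 1) (dY : GMap Y Y 1) (f : GMap X Y 0) (g : GMap Y X 0) : Prop :=
  gdelta dX dY (show (0:ℤ) + 1 = 1 by omega) f = 0 ∧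
  gdelta dY dX (show (0:ℤ) + 1 = 1 by omega) g = 0 ∧
  (∃ H : GMap X X (-1), gdelta dX dX (show (-1:ℤ) + 1 = 0 by omega) H
      = gid X - gcomp (show (0:ℤ) + 0 = 0 by omega) f g) ∧
  (∃ K : GMap Y Y (-1), gdelta dY dY (show (-1:ℤ) + 1 = 0 by omega) K
      = gid Y - gcomp (show (0:ℤ) + 0 = 0 by omega) g f)


section GradedMaps

variable {A : Type*} [Category A]

lemma eqToHom_comp_gmap {X Y : GradedObj A} {n : ℤ} (f : GMap X Y n) {i j : ℤ} (h : i = j) :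
    eqToHom (congrArg X h) ≫ f j = f i ≫ eqToHom (by rw [h]) := by
  subst h
  simp

lemma gcomp_assoc {X Y Z W : GradedObj A} {n m l k p q : ℤ} (hk : n + m = k) (hp : k + l = q)
    (hm : m + l = p) (hq : n + p = q) (f : GMap X Y n) (g : GMap Y Z m) (e : GMap Z W l) :
    gcomp hp (gcomp hk f g) e = gcomp hq f (gcomp hm g e) := by
  funext i
  have key := eqToHom_comp_gmap e (show i + n + m = i + k by omega)
  simp [gcomp, reassoc_of% key]

variable [Preadditive A] {X Y Z : GradedObj A} {n m k : ℤ} (h : n + m = k)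

lemma gcomp_add (f : GMap X Y n) (g g' : GMap Y Z m) :
    gcomp h f (g + g') = gcomp h f g + gcomp h f g' := by
  funext i
  simp [gcomp]

lemma add_gcomp (f f' : GMap X Y n) (g : GMap Y Z m) :
    gcomp h (f + f') g = gcomp h f g + gcomp h f' g := by
  funext i
  simp [gcomp]

lemma gcomp_sub (f : GMap X Y n) (g g' : GMap Y Z m) :
    gcomp h f (g - g') = gcomp h f g - gcomp h f g' := by
  funext i
  simp [gcomp]

lemma sub_gcomp (f f' : GMap X Y n) (g : GMap Y Z m) :
    gcomp h (f - f') g = gcomp h f g - gcomp h f' g := by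
  funext i
  simp [gcomp]

lemma gcomp_zsmul (a : ℤ) (f : GMap X Y n) (g : GMap Y Z m) :
    gcomp h f (a • g) = a • gcomp h f g := by
  funext i
  simp [gcomp]

lemma zsmul_gcomp (a : ℤ) (f : GMap X Y n) (g : GMap Y Z m) :
    gcomp h (a • f) g = a • gcomp h f g := by
  funext i
  simp [gcomp]

lemma gcomp_zero (f : GMap X Y n) : gcomp h f (0 : GMap Y Z m) = 0 := by
  funext i
  simp [gcomp]

lemma zero_gcomp (g : GMap Y Z m) : gcomp h (0 : GMap X Y n) g = 0 := by
  funext i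
  simp [gcomp]

lemma gdelta_add (dX : GMap X X 1) (dY : GMap Y Y 1) (h : n + 1 = m) (f g : GMap X Y n) :
    gdelta dX dY h (f + g) = gdelta dX dY h f + gdelta dX dY h g := by
  simp only [gdelta, add_gcomp, gcomp_add, smul_add]
  abel

lemma gdelta_sub (dX : GMap X X 1) (dY : GMap Y Y 1) (h : n + 1 = m) (f g : GMap X Y n) :
    gdelta dX dY h (f - g) = gdelta dX dY h f - gdelta dX dY h g := by
  simp only [gdelta, sub_gcomp, gcomp_sub, smul_sub]
  abel

/-- The operator `δ` squares to zero when both `d_X` and `d_Y` are differentials. -/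
lemma gdelta_gdelta (dX : GMap X X 1) (dY : GMap Y Y 1)
    (hX : gcomp (show (1 : ℤ) + 1 = 2 by omega) dX dX = 0)
    (hY : gcomp (show (1 : ℤ) + 1 = 2 by omega) dY dY = 0)
    (h : n + 1 = m) (h' : m + 1 = k) (f : GMap X Y n) :
    gdelta dX dY h' (gdelta dX dY h f) = 0 := by
  have hYY : gcomp h' (gcomp h f dY) dY = 0 := by
    rw [gcomp_assoc h h' (show (1 : ℤ) + 1 = 2 by omega) (by omega), hY, gcomp_zero]
  have hXX : gcomp (show 1 + m = k by omega) dX (gcomp (show 1 + n = m by omega) dX f) = 0 := by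
    rw [← gcomp_assoc (show (1 : ℤ) + 1 = 2 by omega) (by omega), hX, zero_gcomp]
  have hXY := gcomp_assoc (show 1 + n = m by omega) h' h (by omega) dX f dY
  have hs : (m.negOnePow : ℤ) = -(n.negOnePow : ℤ) := by
    rw [← h, Int.negOnePow_succ, Units.val_neg]
  simp only [gdelta, sub_gcomp, gcomp_sub, zsmul_gcomp, gcomp_zsmul, hYY, hXX, hXY, hs]
  simp

end GradedMaps

section Functor

variable {A B : Type*} [Category A] [Category B] (F : B ⥤ A) {X Y Z : GradedObj B} {n m k : ℤ}

lemma exists_Fmap_eq [F.Full] (f : GMap (Fgr F X) (Fgr F Y) n) :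
    ∃ fb : GMap X Y n, Fmap F fb = f :=
  ⟨fun i => F.preimage (f i), funext fun i => F.map_preimage (f i)⟩

lemma Fmap_gcomp (h : n + m = k) (f : GMap X Y n) (g : GMap Y Z m) :
    Fmap F (gcomp h f g) = gcomp h (Fmap F f) (Fmap F g) := by
  funext i
  simp [Fmap, gcomp, eqToHom_map]

variable [Preadditive A] [Preadditive B] [F.Additive]

lemma Fmap_add (f g : GMap X Y n) : Fmap F (f + g) = Fmap F f + Fmap F g := by
  funext i
  simp [Fmap]

lemma Fmap_sub (f g : GMap X Y n) : Fmap F (f - g) = Fmap F f - Fmap F g := by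
  funext i
  simp [Fmap]

lemma Fmap_zsmul (a : ℤ) (f : GMap X Y n) : Fmap F (a • f) = a • Fmap F f := by
  funext i
  simp [Fmap, F.map_zsmul]

lemma Fmap_gdelta (dX : GMap X X 1) (dY : GMap Y Y 1) (h : n + 1 = m) (f : GMap X Y n) :
    Fmap F (gdelta dX dY h f) = gdelta (Fmap F dX) (Fmap F dY) h (Fmap F f) := by
  simp only [gdelta, Fmap_sub, Fmap_zsmul, Fmap_gcomp]

end Functor

/-- Proposition `comp`(2): homotopic cochain maps have the same obstruction
against lifting to cochain maps, and if the obstructions vanish, every cochain-map lift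
`f̄` of `f` can be matched by a cochain-map lift `ḡ` of `g` together with a lift of the
homotopy `H` connecting them. -/
theorem statement13 {B C : Type*} [Category B] [Preadditive B] [Category C] [Preadditive C]
    (F : B ⥤ C) [F.Additive] [F.Full] (hF : KerSq F)
    (Xb Yb : GradedObj B)
    (dC : GMap (Fgr F Xb) (Fgr F Xb) 1) (dD : GMap (Fgr F Yb) (Fgr F Yb) 1)
    (hdC : gcomp (show (1:ℤ) + 1 = 2 by omega) dC dC = 0)
    (hdD : gcomp (show (1:ℤ) + 1 = 2 by omega) dD dD = 0)
    (dCb : GMap Xb Xb 1) (hdCb : Fmap F dCb = dC)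
    (hdCbsq : gcomp (show (1:ℤ) + 1 = 2 by omega) dCb dCb = 0)
    (dDb : GMap Yb Yb 1) (hdDb : Fmap F dDb = dD)
    (hdDbsq : gcomp (show (1:ℤ) + 1 = 2 by omega) dDb dDb = 0)
    (n : ℤ) (f g : GMap (Fgr F Xb) (Fgr F Yb) n)
    (hf : gdelta dC dD rfl f = 0) (hg : gdelta dC dD rfl g = 0)
    (H : GMap (Fgr F Xb) (Fgr F Yb) (n - 1))
    (hH : gdelta dC dD (show n - 1 + 1 = n by omega) H = g - f) :
    -- (i) the two obstructions coincide
    (∀ fb gb : GMap Xb Yb n, Fmap F fb = f → Fmap F gb = g →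
      ∃ γ : GMap Xb Yb n, Fmap F γ = 0 ∧
        gdelta dCb dDb rfl fb - gdelta dCb dDb rfl gb = gdelta dCb dDb rfl γ) ∧
    -- (ii) matching cochain-map lifts, with a lifted homotopy
    (∀ fb : GMap Xb Yb n, Fmap F fb = f → gdelta dCb dDb rfl fb = 0 →
      ∃ gb : GMap Xb Yb n, Fmap F gb = g ∧ gdelta dCb dDb rfl gb = 0 ∧
        ∃ Hb : GMap Xb Yb (n - 1), Fmap F Hb = H ∧
          gdelta dCb dDb (show n - 1 + 1 = n by omega) Hb = gb - fb) := by
  obtain ⟨Hb, hHb⟩ := exists_Fmap_eq F H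
  have hFδ : Fmap F (gdelta dCb dDb (show n - 1 + 1 = n by omega) Hb) = g - f := by
    rw [Fmap_gdelta, hdCb, hdDb, hHb, hH]
  have hδδ : gdelta dCb dDb rfl (gdelta dCb dDb (show n - 1 + 1 = n by omega) Hb) = 0 :=
    gdelta_gdelta dCb dDb hdCbsq hdDbsq _ _ Hb
  refine ⟨fun fb gb hfb hgb => ?_, fun fb hfb hδfb => ?_⟩
  · refine ⟨fb - gb + gdelta dCb dDb (by omega) Hb, ?_, ?_⟩
    · rw [Fmap_add, Fmap_sub, hFδ, hfb, hgb]
      abel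
    · rw [gdelta_add, gdelta_sub, hδδ, add_zero]
  · refine ⟨fb + gdelta dCb dDb (by omega) Hb, ?_, ?_, Hb, hHb, ?_⟩
    · rw [Fmap_add, hFδ, hfb, add_sub_cancel]
    · rw [gdelta_add, hδfb, hδδ, add_zero]
    · rw [add_sub_cancel_left]

end Paper
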